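/- There exists a unique T-invariant Borel probability measure ν on [0,1] that is absolutely continuous with respect to Lebesgue measure. Moreover, a version φ of its density dν/dLeb satisfies: φ is bounded below on [0,1] by a strictly positive constant; for every ε > 0, φ is bounded above on [ε, 1]; and there exist δ > 0 and constants c1, c2 > 0 such that c1 ≤ |log x|^{−β} φ(x) ≤ c2 for all x ∈ (0, δ]. -/

import Mathlib

open MeasureTheory Set

/-- The interval map `T` of the example: `T(x) = x (1 + c / |log x|^β)` on `(0, 1/2]`
with `β = 1/γ - 1`, `c = (log 2)^β`, `T(x) = 2x - 1` on `(1/2, 1]`, and `T(0) = 0`. -/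
noncomputable def Tmap (γ : ℝ) (x : ℝ) : ℝ :=
  if x ≤ 0 then 0
  else if x ≤ 1 / 2 then x * (1 + (Real.log 2) ^ (1 / γ - 1) / |Real.log x| ^ (1 / γ - 1))
  else 2 * x - 1

open Filter Topology

structure Br (T S D g : ℝ → ℝ) : Prop where
  T_meas : Measurable T
  T_left : ∀ x ∈ Ioc (0:ℝ) (1/2), T x = S x
  T_right : ∀ x ∈ Ioc (1/2:ℝ) 1, T x = 2 * x - 1
  g_mem : ∀ y ∈ Ioc (0:ℝ) 1, g y ∈ Ioc (0:ℝ) (1/2)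
  S_mem : ∀ x ∈ Ioc (0:ℝ) (1/2), S x ∈ Ioc (0:ℝ) 1
  Sg : ∀ y ∈ Ioc (0:ℝ) 1, S (g y) = y
  gS : ∀ x ∈ Ioc (0:ℝ) (1/2), g (S x) = x
  g_mono : MonotoneOn g (Ioc 0 1)
  g_lt : ∀ y ∈ Ioc (0:ℝ) 1, g y < y
  S_deriv : ∀ x ∈ Ioc (0:ℝ) (1/2), HasDerivAt S (D x) x
  D_ge : ∀ x ∈ Ioc (0:ℝ) (1/2), 1 ≤ D x
  D_mono : MonotoneOn D (Ioc 0 (1/2))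
  g_iter : ∀ η : ℝ, 0 < η → ∃ k : ℕ, g^[k] 1 ≤ η
  g_bd : ∃ C r : ℝ, r < 1 ∧ ∀ y ∈ Ioc (0:ℝ) 1, y / (y - g y) ≤ C * y ^ (-r)

noncomputable def PF (D g : ℝ → ℝ) (f : ℝ → ℝ) (y : ℝ) : ℝ :=
  f (g y) / D (g y) + f ((y + 1) / 2) / 2

structure Good (f : ℝ → ℝ) : Prop where
  anti : AntitoneOn f (Ioc 0 1)
  nn : ∀ x ∈ Ioc (0:ℝ) 1, 0 ≤ f x
  int : IntegrableOn f (Ioc 0 1)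

namespace Br
variable {T S D g : ℝ → ℝ} (h : Br T S D g)
include h

lemma g_mem1 {y : ℝ} (hy : y ∈ Ioc (0:ℝ) 1) : g y ∈ Ioc (0:ℝ) 1 :=
  ⟨(h.g_mem y hy).1, (h.g_mem y hy).2.trans (by norm_num)⟩

lemma half_mem {y : ℝ} (hy : y ∈ Ioc (0:ℝ) 1) : (y + 1) / 2 ∈ Ioc (0:ℝ) 1 :=
  ⟨by linarith [hy.1], by linarith [hy.2]⟩

lemma D_pos {x : ℝ} (hx : x ∈ Ioc (0:ℝ) (1/2)) : 0 < D x := lt_of_lt_of_le one_pos (h.D_ge x hx)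

lemma g_one : g 1 = 1 / 2 := by
  have h1 : S (1/2) ≤ 1 := (h.S_mem (1/2) ⟨by norm_num, le_rfl⟩).2
  have h2 := h.g_mono (h.S_mem (1/2) ⟨by norm_num, le_rfl⟩) (b := 1) ⟨one_pos, le_rfl⟩ h1
  rw [h.gS (1/2) ⟨by norm_num, le_rfl⟩] at h2
  exact le_antisymm (h.g_mem 1 ⟨one_pos, le_rfl⟩).2 h2

lemma S_inj : InjOn S (Ioc 0 (1/2)) := by
  intro x hx y hy e
  rw [← h.gS x hx, e, h.gS y hy]

lemma meas_left {A : Set ℝ} (hA : MeasurableSet A) : MeasurableSet (T ⁻¹' A ∩ Ioc 0 (1/2)) :=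
  (h.T_meas hA).inter measurableSet_Ioc

lemma image_left (A : Set ℝ) : S '' (T ⁻¹' A ∩ Ioc 0 (1/2)) = A ∩ Ioc 0 1 := by
  ext y
  constructor
  · rintro ⟨x, ⟨hx1, hx2⟩, rfl⟩
    have : T x ∈ A := hx1
    rw [h.T_left x hx2] at this
    exact ⟨this, h.S_mem x hx2⟩
  · rintro ⟨hy1, hy2⟩
    refine ⟨g y, ⟨?_, h.g_mem y hy2⟩, h.Sg y hy2⟩
    simp only [mem_preimage, h.T_left _ (h.g_mem y hy2), h.Sg y hy2, hy1]

lemma image_right (A : Set ℝ) :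
    (fun x : ℝ => 2 * x - 1) '' (T ⁻¹' A ∩ Ioc (1/2) 1) = A ∩ Ioc 0 1 := by
  ext y
  constructor
  · rintro ⟨x, ⟨hx1, hx2⟩, rfl⟩
    have : T x ∈ A := hx1
    rw [h.T_right x hx2] at this
    exact ⟨this, by linarith [hx2.1], by linarith [hx2.2]⟩
  · rintro ⟨hy1, hy2⟩
    have hm : (y + 1) / 2 ∈ Ioc (1/2:ℝ) 1 := ⟨by linarith [hy2.1], by linarith [hy2.2]⟩
    refine ⟨(y + 1) / 2, ⟨?_, hm⟩, by ring⟩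
    simp only [mem_preimage, h.T_right _ hm]
    convert hy1 using 1; ring

lemma int_left {A : Set ℝ} (hA : MeasurableSet A) {f : ℝ → ℝ} (hf : IntegrableOn f (Ioc 0 1)) :
    IntegrableOn (fun y => f (g y) / D (g y)) (A ∩ Ioc 0 1) ∧
    ∫ y in A ∩ Ioc 0 1, f (g y) / D (g y) = ∫ x in T ⁻¹' A ∩ Ioc 0 (1/2), f x := by
  have hd : ∀ x ∈ T ⁻¹' A ∩ Ioc 0 (1/2), HasDerivWithinAt S (D x) (T ⁻¹' A ∩ Ioc 0 (1/2)) x :=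
    fun x hx => (h.S_deriv x hx.2).hasDerivWithinAt
  have hinj : InjOn S (T ⁻¹' A ∩ Ioc 0 (1/2)) := h.S_inj.mono inter_subset_right
  have heq : ∀ x ∈ T ⁻¹' A ∩ Ioc 0 (1/2), |D x| • (f (g (S x)) / D (g (S x))) = f x := by
    intro x hx
    rw [h.gS x hx.2, abs_of_pos (h.D_pos hx.2), smul_eq_mul]
    field_simp [(h.D_pos hx.2).ne']
  rw [← h.image_left A]
  constructor
  · rw [integrableOn_image_iff_integrableOn_abs_deriv_smul (h.meas_left hA) hd hinj]
    rw [integrableOn_congr_fun heq (h.meas_left hA)]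
    exact hf.mono_set fun x hx => ⟨hx.2.1, hx.2.2.trans (by norm_num)⟩
  · rw [integral_image_eq_integral_abs_deriv_smul (h.meas_left hA) hd hinj]
    exact setIntegral_congr_fun (h.meas_left hA) heq

lemma int_right {A : Set ℝ} (hA : MeasurableSet A) {f : ℝ → ℝ} (hf : IntegrableOn f (Ioc 0 1)) :
    IntegrableOn (fun y => f ((y + 1) / 2) / 2) (A ∩ Ioc 0 1) ∧
    ∫ y in A ∩ Ioc 0 1, f ((y + 1) / 2) / 2 = ∫ x in T ⁻¹' A ∩ Ioc (1/2) 1, f x := by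
  have hm : MeasurableSet (T ⁻¹' A ∩ Ioc (1/2:ℝ) 1) := (h.T_meas hA).inter measurableSet_Ioc
  have hd : ∀ x ∈ T ⁻¹' A ∩ Ioc (1/2:ℝ) 1,
      HasDerivWithinAt (fun x : ℝ => 2 * x - 1) 2 (T ⁻¹' A ∩ Ioc (1/2:ℝ) 1) x := by
    intro x hx
    have := ((hasDerivAt_id x).const_mul 2).sub_const 1
    simpa using this.hasDerivWithinAt
  have hinj : InjOn (fun x : ℝ => 2 * x - 1) (T ⁻¹' A ∩ Ioc (1/2:ℝ) 1) := by
    intro x _ y _ e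
    simp only at e; linarith
  have heq : ∀ x ∈ T ⁻¹' A ∩ Ioc (1/2:ℝ) 1, |(2:ℝ)| • (f ((2 * x - 1 + 1) / 2) / 2) = f x := by
    intro x hx
    have : (2 * x - 1 + 1) / 2 = x := by ring
    rw [this, smul_eq_mul, abs_of_pos two_pos]; ring
  rw [← h.image_right A]
  constructor
  · rw [integrableOn_image_iff_integrableOn_abs_deriv_smul hm hd hinj]
    rw [integrableOn_congr_fun heq hm]
    exact hf.mono_set fun x hx => ⟨by linarith [hx.2.1], hx.2.2⟩
  · rw [integral_image_eq_integral_abs_deriv_smul hm hd hinj]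
    exact setIntegral_congr_fun hm heq

lemma PF_int {f : ℝ → ℝ} (hf : IntegrableOn f (Ioc 0 1)) : IntegrableOn (PF D g f) (Ioc 0 1) := by
  have h1 := (h.int_left MeasurableSet.univ hf).1
  have h2 := (h.int_right MeasurableSet.univ hf).1
  rw [univ_inter] at h1 h2
  exact h1.add h2

lemma dual {A : Set ℝ} (hA : MeasurableSet A) {f : ℝ → ℝ} (hf : IntegrableOn f (Ioc 0 1)) :
    ∫ y in A ∩ Ioc 0 1, PF D g f y = ∫ x in T ⁻¹' A ∩ Ioc 0 1, f x := by
  have h1 := h.int_left hA hf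
  have h2 := h.int_right hA hf
  have hu : T ⁻¹' A ∩ Ioc (0:ℝ) 1 = (T ⁻¹' A ∩ Ioc 0 (1/2)) ∪ (T ⁻¹' A ∩ Ioc (1/2) 1) := by
    rw [← inter_union_distrib_left, Ioc_union_Ioc_eq_Ioc (by norm_num) (by norm_num)]
  unfold PF
  rw [integral_add h1.1 h2.1, h1.2, h2.2, hu, setIntegral_union]
  · refine Disjoint.mono inter_subset_right inter_subset_right ?_
    rw [Set.disjoint_left]
    intro x hx hx'
    linarith [hx.2, hx'.1]
  · exact (h.T_meas hA).inter measurableSet_Ioc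
  · exact hf.mono_set fun x hx => ⟨hx.2.1, hx.2.2.trans (by norm_num)⟩
  · exact hf.mono_set fun x hx => ⟨by linarith [hx.2.1], hx.2.2⟩

lemma PF_total {f : ℝ → ℝ} (hf : IntegrableOn f (Ioc 0 1)) :
    ∫ y in Ioc 0 1, PF D g f y = ∫ x in Ioc 0 1, f x := by
  simpa using h.dual MeasurableSet.univ hf

lemma PF_good {f : ℝ → ℝ} (hf : Good f) : Good (PF D g f) where
  anti := by
    intro x hx y hy hxy
    have e1 := hf.anti (h.g_mem1 hx) (h.g_mem1 hy) (h.g_mono hx hy hxy)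
    have e2 := hf.anti (h.half_mem hx) (h.half_mem hy) (by linarith)
    have e3 := h.D_mono (h.g_mem x hx) (h.g_mem y hy) (h.g_mono hx hy hxy)
    have e4 := h.D_pos (h.g_mem x hx)
    have e5 := hf.nn _ (h.g_mem1 hx)
    unfold PF
    gcongr
  nn := by
    intro x hx
    have := hf.nn _ (h.g_mem1 hx)
    have := hf.nn _ (h.half_mem hx)
    have := h.D_pos (h.g_mem x hx)
    unfold PF; positivity
  int := h.PF_int hf.int

lemma PF_mono {f f' : ℝ → ℝ} (hf : ∀ x ∈ Ioc (0:ℝ) 1, f x ≤ f' x) :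
    ∀ x ∈ Ioc (0:ℝ) 1, PF D g f x ≤ PF D g f' x := by
  intro x hx
  have := hf _ (h.g_mem1 hx)
  have := hf _ (h.half_mem hx)
  have := h.D_pos (h.g_mem x hx)
  unfold PF; gcongr

lemma iter_good {f : ℝ → ℝ} (hf : Good f) (n : ℕ) : Good ((PF D g)^[n] f) := by
  induction n with
  | zero => exact hf
  | succ n ih => rw [Function.iterate_succ_apply']; exact h.PF_good ih

lemma iter_total {f : ℝ → ℝ} (hf : Good f) (n : ℕ) :
    ∫ x in Ioc 0 1, (PF D g)^[n] f x = ∫ x in Ioc 0 1, f x := by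
  induction n with
  | zero => rfl
  | succ n ih => rw [Function.iterate_succ_apply', h.PF_total (h.iter_good hf n).int, ih]

lemma iter_dual {A : Set ℝ} (hA : MeasurableSet A) {f : ℝ → ℝ} (hf : Good f) (n : ℕ) :
    ∫ y in A ∩ Ioc 0 1, (PF D g)^[n] f y = ∫ x in T^[n] ⁻¹' A ∩ Ioc 0 1, f x := by
  induction n generalizing A with
  | zero => rfl
  | succ n ih =>
    rw [Function.iterate_succ_apply', h.dual hA (h.iter_good hf n).int, ih (h.T_meas hA),
      Function.iterate_succ', preimage_comp]

lemma iter_ge {f : ℝ → ℝ} (hf : Good f) (k : ℕ) {y : ℝ} (hy : y ∈ Ioc (0:ℝ) 1) :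
    g^[k] y ∈ Ioc (0:ℝ) 1 ∧ f (g^[k] y) / D (1/2) ^ k ≤ (PF D g)^[k] f y := by
  induction k generalizing f with
  | zero => exact ⟨hy, by simp⟩
  | succ k ih =>
    obtain ⟨i1, i2⟩ := ih (h.PF_good hf)
    rw [Function.iterate_succ_apply', Function.iterate_succ_apply]
    refine ⟨h.g_mem1 i1, le_trans ?_ i2⟩
    have hm := h.g_mem _ i1
    have a1 := h.D_mono hm (b := 1/2) ⟨by norm_num, le_rfl⟩ hm.2
    have a2 := h.D_pos hm
    have a3 := h.D_pos (x := 1/2) ⟨by norm_num, le_rfl⟩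
    have a4 := hf.nn _ (h.g_mem1 i1)
    have a5 := hf.nn _ (h.half_mem i1)
    rw [pow_succ', ← div_div]
    gcongr
    unfold PF
    have : f (g (g^[k] y)) / D (1/2) ≤ f (g (g^[k] y)) / D (g (g^[k] y)) := by gcongr
    linarith

end Br

namespace Good
variable {f f' : ℝ → ℝ}

lemma add (hf : Good f) (hf' : Good f') : Good (fun x => f x + f' x) where
  anti := fun _ hx _ hy hxy => add_le_add (hf.anti hx hy hxy) (hf'.anti hx hy hxy)
  nn := fun x hx => add_nonneg (hf.nn x hx) (hf'.nn x hx)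
  int := hf.int.add hf'.int

lemma const {c : ℝ} (hc : 0 ≤ c) : Good (fun _ => c) where
  anti := fun _ _ _ _ _ => le_rfl
  nn := fun _ _ => hc
  int := integrableOn_const (by simp)

lemma smul (hf : Good f) {c : ℝ} (hc : 0 ≤ c) : Good (fun x => c * f x) where
  anti := fun _ hx _ hy hxy => mul_le_mul_of_nonneg_left (hf.anti hx hy hxy) hc
  nn := fun x hx => mul_nonneg hc (hf.nn x hx)
  int := hf.int.const_mul c

lemma intOn (hf : Good f) {a b : ℝ} (ha : 0 ≤ a) (hb : b ≤ 1) : IntegrableOn f (Ioc a b) :=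
  hf.int.mono_set (Ioc_subset_Ioc ha hb)

lemma ge_mul (hf : Good f) {a b : ℝ} (ha : 0 ≤ a) (hab : a ≤ b) (hb0 : 0 < b) (hb : b ≤ 1) :
    f b * (b - a) ≤ ∫ x in Ioc a b, f x := by
  have : ∫ x in Ioc a b, f b ≤ ∫ x in Ioc a b, f x := by
    refine setIntegral_mono_on (integrableOn_const (by simp)) (hf.intOn ha hb) measurableSet_Ioc ?_
    intro x hx
    exact hf.anti ⟨ha.trans_lt hx.1, hx.2.trans hb⟩ ⟨hb0, hb⟩ hx.2
  rw [setIntegral_const, Measure.real, Real.volume_Ioc, ENNReal.toReal_ofReal (by linarith),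
    smul_eq_mul] at this
  linarith

lemma le_mul (hf : Good f) {a b : ℝ} (ha : 0 < a) (hab : a ≤ b) (hb : b ≤ 1) :
    ∫ x in Ioc a b, f x ≤ f a * (b - a) := by
  have : ∫ x in Ioc a b, f x ≤ ∫ x in Ioc a b, f a := by
    refine setIntegral_mono_on (hf.intOn ha.le hb) (integrableOn_const (by simp)) measurableSet_Ioc ?_
    intro x hx
    exact hf.anti ⟨ha, hab.trans hb⟩ ⟨ha.trans hx.1, hx.2.trans hb⟩ hx.1.le
  rw [setIntegral_const, Measure.real, Real.volume_Ioc, ENNReal.toReal_ofReal (by linarith),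
    smul_eq_mul] at this
  linarith

lemma split (hf : Good f) {a b c : ℝ} (ha : 0 ≤ a) (hab : a ≤ b) (hbc : b ≤ c) (hc : c ≤ 1) :
    ∫ x in Ioc a c, f x = (∫ x in Ioc a b, f x) + ∫ x in Ioc b c, f x := by
  rw [← Ioc_union_Ioc_eq_Ioc hab hbc, setIntegral_union (Ioc_disjoint_Ioc_of_le le_rfl)
    measurableSet_Ioc (hf.intOn ha (hbc.trans hc)) (hf.intOn (ha.trans hab) hc)]

lemma int_nonneg (hf : Good f) {a b : ℝ} (ha : 0 ≤ a) (hb : b ≤ 1) :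
    0 ≤ ∫ x in Ioc a b, f x :=
  setIntegral_nonneg measurableSet_Ioc fun x hx => hf.nn x ⟨ha.trans_lt hx.1, hx.2.trans hb⟩

end Good

namespace Br
variable {T S D g : ℝ → ℝ} (h : Br T S D g)
include h

lemma pre_Ioc {y : ℝ} (hy : y ∈ Ioc (0:ℝ) 1) :
    T ⁻¹' (Ioc 0 y) ∩ Ioc 0 1 = Ioc 0 (g y) ∪ Ioc (1/2) ((y + 1) / 2) := by
  ext x
  constructor
  · rintro ⟨hx1, hx2⟩
    have hx1 : T x ∈ Ioc 0 y := hx1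
    by_cases hx : x ≤ 1/2
    · left
      have hm : x ∈ Ioc (0:ℝ) (1/2) := ⟨hx2.1, hx⟩
      rw [h.T_left x hm] at hx1
      have := h.g_mono (h.S_mem x hm) hy hx1.2
      rw [h.gS x hm] at this
      exact ⟨hx2.1, this⟩
    · right
      push Not at hx
      rw [h.T_right x ⟨hx, hx2.2⟩] at hx1
      exact ⟨hx, by linarith [hx1.2]⟩
  · rintro (hx | hx)
    · have hm : x ∈ Ioc (0:ℝ) (1/2) := ⟨hx.1, hx.2.trans (h.g_mem y hy).2⟩
      refine ⟨?_, hx.1, hm.2.trans (by norm_num)⟩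
      simp only [mem_preimage, h.T_left x hm]
      refine ⟨(h.S_mem x hm).1, ?_⟩
      by_contra hc
      push Not at hc
      have := h.g_mono hy (h.S_mem x hm) hc.le
      rw [h.gS x hm] at this
      have e : x = g y := le_antisymm hx.2 this
      rw [e, h.Sg y hy] at hc
      exact lt_irrefl _ hc
    · have hm : x ∈ Ioc (1/2:ℝ) 1 := ⟨hx.1, by linarith [hx.2, hy.2]⟩
      refine ⟨?_, by linarith [hx.1], hm.2⟩
      simp only [mem_preimage, h.T_right x hm]
      exact ⟨by linarith [hx.1], by linarith [hx.2]⟩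

lemma key {f : ℝ → ℝ} (hf : Good f) {y : ℝ} (hy : y ∈ Ioc (0:ℝ) 1) :
    (∫ x in Ioc (g y) y, f x) + (∫ x in Ioc 0 y, PF D g f x) =
      (∫ x in Ioc (1/2) ((y + 1) / 2), f x) + ∫ x in Ioc 0 y, f x := by
  have h1 := h.dual (measurableSet_Ioc (a := 0) (b := y)) hf.int
  have hgy := h.g_mem y hy
  rw [h.pre_Ioc hy, inter_eq_left.2 (Ioc_subset_Ioc_right hy.2), setIntegral_union
    (Ioc_disjoint_Ioc_of_le hgy.2) measurableSet_Ioc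
    (hf.intOn le_rfl (h.g_mem1 hy).2) (hf.intOn (by norm_num) (h.half_mem hy).2)] at h1
  rw [h1, hf.split le_rfl hgy.1.le (h.g_lt y hy).le hy.2]
  ring

/-- iterates of the constant one -/
lemma f_good (n : ℕ) : Good ((PF D g)^[n] (fun _ => 1)) := h.iter_good (Good.const zero_le_one) n

lemma f_total (n : ℕ) : ∫ x in Ioc 0 1, (PF D g)^[n] (fun _ => 1) x = 1 := by
  rw [h.iter_total (Good.const zero_le_one)]; simp

lemma f_le (n : ℕ) {x : ℝ} (hx : x ∈ Ioc (0:ℝ) 1) : (PF D g)^[n] (fun _ => 1) x ≤ 1 / x := by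
  have h1 := (h.f_good n).ge_mul le_rfl hx.1.le hx.1 hx.2
  have h2 := (h.f_good n).split le_rfl hx.1.le hx.2 le_rfl
  have h3 := (h.f_good n).int_nonneg hx.1.le le_rfl
  rw [h.f_total] at h2
  rw [le_div_iff₀ hx.1]
  linarith

end Br

noncomputable def Sm (D g : ℝ → ℝ) (n : ℕ) (x : ℝ) : ℝ :=
  ∑ k ∈ Finset.range n, (PF D g)^[k] (fun _ => 1) x

lemma PF_Sm (D g : ℝ → ℝ) (n : ℕ) (y : ℝ) :
    PF D g (Sm D g n) y = Sm D g n y + (PF D g)^[n] (fun _ => 1) y - 1 := by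
  have h1 : PF D g (Sm D g n) y = ∑ k ∈ Finset.range n, (PF D g)^[k+1] (fun _ => 1) y := by
    simp only [Function.iterate_succ_apply']
    simp only [PF, Sm, Finset.sum_add_distrib, Finset.sum_div]
  have h2 := Finset.sum_range_succ (fun k => (PF D g)^[k] (fun _ => 1) y) n
  rw [Finset.sum_range_succ'] at h2
  rw [h1, Sm]
  simp only [Function.iterate_zero, id] at h2
  linarith

namespace Br
variable {T S D g : ℝ → ℝ} (h : Br T S D g)
include h

lemma Sm_good (n : ℕ) : Good (Sm D g n) := by
  induction n with
  | zero => 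
    have : Sm D g 0 = fun _ => 0 := by ext; simp [Sm]
    rw [this]; exact Good.const le_rfl
  | succ n ih =>
    have : Sm D g (n+1) = fun x => Sm D g n x + (PF D g)^[n] (fun _ => 1) x := by
      ext; simp [Sm, Finset.sum_range_succ]
    rw [this]; exact ih.add (h.f_good n)

lemma Sm_key (n : ℕ) {y : ℝ} (hy : y ∈ Ioc (0:ℝ) 1) :
    (∫ x in Ioc (g y) y, Sm D g n x) + (∫ x in Ioc 0 y, (PF D g)^[n] (fun _ => 1) x) ≤
      Sm D g n (1/2) * (y / 2) + y := by
  have h1 := h.key (h.Sm_good n) hy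
  have h2 : ∫ x in Ioc 0 y, PF D g (Sm D g n) x =
      (∫ x in Ioc 0 y, Sm D g n x) + (∫ x in Ioc 0 y, (PF D g)^[n] (fun _ => 1) x) - y := by
    simp only [PF_Sm]
    have a1 := (h.Sm_good n).intOn le_rfl hy.2
    have a2 := (h.f_good n).intOn le_rfl hy.2
    have a3 : IntegrableOn (fun x => Sm D g n x + (PF D g)^[n] (fun _ => 1) x) (Ioc 0 y) :=
      a1.add a2
    rw [integral_sub a3 (integrableOn_const (by simp)), integral_add a1 a2]
    simp [hy.1.le]
  have h3 := (h.Sm_good n).le_mul (a := 1/2) (b := (y+1)/2) (by norm_num) (by linarith [hy.1]) (h.half_mem hy).2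
  have : (y + 1) / 2 - 1/2 = y / 2 := by ring
  rw [this] at h3
  linarith

lemma Sm_bd (n : ℕ) {y : ℝ} (hy : y ∈ Ioc (0:ℝ) 1) :
    Sm D g n y * (y - g y) ≤ Sm D g n (1/2) * (y / 2) + y := by
  have h1 := h.Sm_key n hy
  have h2 := (h.Sm_good n).ge_mul (h.g_mem y hy).1.le (h.g_lt y hy).le hy.1 hy.2
  have h3 := (h.f_good n).int_nonneg le_rfl hy.2
  linarith

lemma Sm_mono : Monotone (fun n => Sm D g n (1/2)) := by
  apply monotone_nat_of_le_succ
  intro n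
  simp only [Sm, Finset.sum_range_succ]
  linarith [(h.f_good n).nn (1/2) ⟨by norm_num, by norm_num⟩]

lemma Sm_tendsto : Tendsto (fun n => Sm D g n (1/2)) atTop atTop := by
  refine (tendsto_atTop_of_monotone h.Sm_mono).resolve_right ?_
  rintro ⟨l, hl⟩
  have hM : ∀ n, Sm D g n (1/2) ≤ l := fun n => h.Sm_mono.ge_of_tendsto hl n
  have hm : (1/2:ℝ) ∈ Ioc (0:ℝ) 1 := ⟨by norm_num, by norm_num⟩
  have h1m : (1:ℝ) ∈ Ioc (0:ℝ) 1 := ⟨by norm_num, le_rfl⟩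
  have hsum : Summable (fun k => (PF D g)^[k] (fun _ => 1) (1/2)) :=
    summable_of_sum_range_le (c := l) (fun k => (h.f_good k).nn _ hm) hM
  have ht := hsum.tendsto_atTop_zero
  have hl0 : 0 ≤ l := by simpa [Sm] using hM 0
  obtain ⟨k, hk⟩ := h.g_iter (1 / (l + 2)) (by positivity)
  have hym := (h.iter_ge (Good.const zero_le_one) k h1m).1
  set y := g^[k] 1 with hy
  have hlow : ∀ n, 1/2 ≤ (PF D g)^[n] (fun _ => 1) y := by
    intro n
    have a1 := h.Sm_key n hym
    have a2 := (h.Sm_good n).int_nonneg (h.g_mem y hym).1.le hym.2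
    have a3 := (h.f_good n).split le_rfl hym.1.le hym.2 le_rfl
    have a4 := (h.f_good n).le_mul hym.1 hym.2 le_rfl
    have a5 := (h.f_good n).nn y hym
    rw [h.f_total] at a3
    have a6 : Sm D g n (1/2) * (y/2) ≤ l * (y / 2) := 
      mul_le_mul_of_nonneg_right (hM n) (by linarith [hym.1])
    have a7 : y * (l + 2) ≤ 1 := by rwa [le_div_iff₀ (by positivity)] at hk
    nlinarith [hym.1]
  have hup : ∀ n, (PF D g)^[n] (fun _ => 1) y / D (1/2) ^ k ≤ (PF D g)^[k + n] (fun _ => 1) (1/2) := by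
    intro n
    have a1 := (h.iter_ge (h.f_good n) k h1m).2
    rw [← Function.iterate_add_apply] at a1
    exact a1.trans ((h.f_good (k+n)).anti hm h1m (by norm_num))
  have hD := h.D_pos (x := 1/2) ⟨by norm_num, le_rfl⟩
  have hpos : 0 < 1 / 2 / D (1/2) ^ k := by positivity
  obtain ⟨n, hn⟩ := ((tendsto_order.1 ht).2 _ hpos).exists_forall_of_atTop
  have b1 := hn (k + n) (by omega)
  have b2 := hup n
  have b3 : 1 / 2 / D (1/2) ^ k ≤ (PF D g)^[n] (fun _ => 1) y / D (1/2) ^ k := by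
    gcongr; exact hlow n
  linarith

lemma exists_phi : ∃ φ : ℝ → ℝ, AntitoneOn φ (Ioc 0 1) ∧ φ (1/2) = 1 ∧
    (∀ y ∈ Ioc (0:ℝ) 1, 0 ≤ φ y) ∧ (∀ y ∈ Ioc (0:ℝ) 1, PF D g φ y = φ y) ∧
    (∀ y ∈ Ioc (0:ℝ) 1, φ y * (y - g y) ≤ y / 2) := by
  classical
  have hm : (1/2:ℝ) ∈ Ioc (0:ℝ) 1 := ⟨by norm_num, by norm_num⟩
  let U : Ultrafilter ℕ := hyperfilter ℕ
  have hU : (U : Filter ℕ) ≤ atTop := by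
    rw [← Nat.cofinite_eq_atTop]; exact hyperfilter_le_cofinite
  let s : ℕ → ℝ := fun n => Sm D g n (1/2)
  have hs : Tendsto s U atTop := h.Sm_tendsto.mono_left hU
  have hs1 : ∀ᶠ n in (U : Filter ℕ), 1 ≤ s n := hs.eventually_ge_atTop 1
  let b : ℕ → ℝ → ℝ := fun n y => Sm D g n y / s n
  have hbd : ∀ y ∈ Ioc (0:ℝ) 1, ∀ᶠ n in (U : Filter ℕ), b n y * (y - g y) ≤ y / 2 + y / s n := by
    intro y hy
    filter_upwards [hs1] with n hn
    have := h.Sm_bd n hy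
    have hp : 0 < s n := by linarith
    simp only [b]
    rw [div_mul_eq_mul_div, div_le_iff₀ hp, add_mul, div_mul_cancel₀ _ hp.ne']
    linarith
  have hnn : ∀ y ∈ Ioc (0:ℝ) 1, ∀ᶠ n in (U : Filter ℕ), 0 ≤ b n y := by
    intro y hy
    filter_upwards [hs1] with n hn
    exact div_nonneg ((h.Sm_good n).nn y hy) (by linarith)
  have hlim : ∀ y, ∃ l, y ∈ Ioc (0:ℝ) 1 → Tendsto (fun n => b n y) U (𝓝 l) := by
    intro y
    by_cases hy : y ∈ Ioc (0:ℝ) 1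
    · have hgy := h.g_lt y hy
      have : ∀ᶠ n in (U : Filter ℕ), b n y ∈ Icc 0 (2 * y / (y - g y)) := by
        filter_upwards [hbd y hy, hnn y hy, hs1] with n h1 h2 h3
        refine ⟨h2, ?_⟩
        rw [le_div_iff₀ (by linarith)]
        have : y / s n ≤ y := div_le_self hy.1.le h3
        linarith [hy.1]
      obtain ⟨l, -, hl⟩ := (isCompact_Icc (a := (0:ℝ)) (b := 2 * y / (y - g y))).ultrafilter_le_nhds
        (U.map (fun n => b n y)) (by rw [le_principal_iff]; exact this)
      exact ⟨l, fun _ => hl⟩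
    · exact ⟨0, fun hc => absurd hc hy⟩
  choose φ hφ using hlim
  refine ⟨φ, ?_, ?_, ?_, ?_, ?_⟩
  · intro x hx y hy hxy
    refine le_of_tendsto_of_tendsto (hφ y hy) (hφ x hx) ?_
    filter_upwards [hs1] with n hn
    have := (h.Sm_good n).anti hx hy hxy
    simp only [b]
    gcongr
  · refine tendsto_nhds_unique (hφ _ hm) ?_
    refine tendsto_const_nhds.congr' ?_
    filter_upwards [hs1] with n hn
    have hp : s n ≠ 0 := by linarith
    exact (div_self hp).symm
  · exact fun y hy => ge_of_tendsto (hφ y hy) (hnn y hy)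
  · intro y hy
    have h1 : Tendsto (fun n => PF D g (b n) y) U (𝓝 (PF D g φ y)) := by
      unfold PF
      exact ((hφ _ (h.g_mem1 hy)).div_const _).add ((hφ _ (h.half_mem hy)).div_const _)
    have h2 : Tendsto (fun n => ((PF D g)^[n] (fun _ => 1) y - 1) / s n) U (𝓝 0) := by
      have hz : Tendsto (fun n => (1 / y + 1) / s n) U (𝓝 0) := hs.const_div_atTop _
      refine squeeze_zero_norm' ?_ hz
      filter_upwards [hs1] with n hn
      have a1 := h.f_le n hy
      have a2 := (h.f_good n).nn y hy
      have a3 : 0 < 1 / y := by have := hy.1; positivity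
      rw [Real.norm_eq_abs, abs_div, abs_of_pos (by linarith : 0 < s n)]
      gcongr
      rw [abs_le]; constructor <;> linarith
    have h3 := (hφ y hy).add h2
    rw [add_zero] at h3
    refine tendsto_nhds_unique h1 (h3.congr ?_)
    intro n
    have e : PF D g (b n) y = PF D g (Sm D g n) y / s n := by
      simp only [PF, b]; ring
    rw [e, PF_Sm]
    simp only [b]; ring
  · intro y hy
    have hz : Tendsto (fun n => y / s n) U (𝓝 0) := hs.const_div_atTop _
    have h2 : Tendsto (fun n => y / 2 + y / s n) U (𝓝 (y / 2)) := by
      simpa using hz.const_add (y / 2)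
    exact le_of_tendsto_of_tendsto ((hφ y hy).mul_const _) h2 (hbd y hy)

lemma good_phi {φ : ℝ → ℝ} (h1 : AntitoneOn φ (Ioc 0 1)) (h2 : ∀ y ∈ Ioc (0:ℝ) 1, 0 ≤ φ y)
    (h3 : ∀ y ∈ Ioc (0:ℝ) 1, φ y * (y - g y) ≤ y / 2) : Good φ := by
  refine ⟨h1, h2, ?_⟩
  obtain ⟨C, r, hr, hC⟩ := h.g_bd
  have hi : IntegrableOn (fun y : ℝ => C * y ^ (-r)) (Ioc 0 1) := by
    have := (intervalIntegral.intervalIntegrable_rpow' (a := 0) (b := 1) (r := -r) (by linarith)).1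
    exact this.const_mul C
  refine Integrable.mono' hi (aemeasurable_restrict_of_antitoneOn measurableSet_Ioc h1).aestronglyMeasurable ?_
  filter_upwards [ae_restrict_mem measurableSet_Ioc] with y hy
  rw [Real.norm_eq_abs, abs_of_nonneg (h2 y hy)]
  refine le_trans ?_ (hC y hy)
  rw [le_div_iff₀ (by linarith [h.g_lt y hy])]
  linarith [h3 y hy, hy.1]

/-- normalized invariant density -/
lemma exists_density : ∃ φ : ℝ → ℝ, Good φ ∧ 0 < φ 1 ∧ (∀ y ∈ Ioc (0:ℝ) 1, PF D g φ y = φ y) ∧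
    ∫ x in Ioc 0 1, φ x = 1 := by
  obtain ⟨φ, p1, p2, p3, p4, p5⟩ := h.exists_phi
  have hg := h.good_phi p1 p3 p5
  have h1m : (1:ℝ) ∈ Ioc (0:ℝ) 1 := ⟨by norm_num, le_rfl⟩
  have hp1 : 0 < φ 1 := by
    have := p4 1 h1m
    rw [PF, h.g_one, p2] at this
    norm_num at this
    have hD := inv_pos.2 (h.D_pos (x := 1/2) ⟨by norm_num, le_rfl⟩)
    norm_num at hD
    have e : 0 < (D (1/2))⁻¹ := inv_pos.2 (h.D_pos (x := 1/2) ⟨by norm_num, le_rfl⟩)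
    linarith
  have hZ : 0 < ∫ x in Ioc 0 1, φ x := by
    have := hg.ge_mul le_rfl zero_le_one one_pos le_rfl
    linarith
  set Z := ∫ x in Ioc 0 1, φ x with hZd
  refine ⟨fun x => Z⁻¹ * φ x, hg.smul (by positivity), by positivity, ?_, ?_⟩
  · intro y hy
    have := p4 y hy
    simp only
    rw [← this]
    simp only [PF]; ring
  · rw [integral_const_mul, ← hZd]
    field_simp

end Br

lemma approx_good {ψ : ℝ → ℝ} (hψ : IntegrableOn ψ (Ioc 0 1)) {ε : ℝ} (hε : 0 < ε) :
    ∃ f1 f2 : ℝ → ℝ, ∃ C : ℝ, Good f1 ∧ Good f2 ∧ (∀ x ∈ Ioc (0:ℝ) 1, f1 x ≤ C ∧ f2 x ≤ C) ∧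
      ∫ x in Ioc 0 1, |ψ x - (f1 x - f2 x)| ≤ ε := by
  obtain ⟨u, -, hu1, hu2, hu3⟩ := Integrable.exists_hasCompactSupport_integral_sub_le hψ (half_pos hε)
  obtain ⟨p, hp⟩ := exists_polynomial_near_of_continuousOn 0 1 u hu2.continuousOn (ε/2) (half_pos hε)
  obtain ⟨c, hc⟩ := (isCompact_Icc (a := (0:ℝ)) (b := 1)).exists_bound_of_continuousOn
    (p.continuous.continuousOn)
  obtain ⟨Λ, hΛ⟩ := (isCompact_Icc (a := (0:ℝ)) (b := 1)).exists_bound_of_continuousOn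
    (p.derivative.continuous.continuousOn)
  have hc0 : 0 ≤ c := (norm_nonneg _).trans (hc 0 ⟨le_rfl, zero_le_one⟩)
  have hΛ0 : 0 ≤ Λ := (norm_nonneg _).trans (hΛ 0 ⟨le_rfl, zero_le_one⟩)
  have hsub : Ioc (0:ℝ) 1 ⊆ Icc 0 1 := Ioc_subset_Icc_self
  have hcont : Continuous (fun x : ℝ => p.eval x + (Λ * (1 - x) + c)) := by
    have := p.continuous
    fun_prop
  refine ⟨fun x => p.eval x + (Λ * (1 - x) + c), fun x => Λ * (1 - x) + c, 2 * c + Λ,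
    ⟨?_, ?_, ?_⟩, ⟨?_, ?_, ?_⟩, ?_, ?_⟩
  · refine AntitoneOn.mono ?_ hsub
    have hd : ∀ x : ℝ, HasDerivAt (fun x : ℝ => p.eval x + (Λ * (1 - x) + c))
        (p.derivative.eval x + Λ * (-1)) x := by
      intro x
      exact (p.hasDerivAt x).add ((((hasDerivAt_id x).const_sub 1).const_mul Λ).add_const c)
    refine antitoneOn_of_deriv_nonpos (convex_Icc 0 1) hcont.continuousOn
      (fun x _ => (hd x).differentiableAt.differentiableWithinAt) ?_
    intro x hx
    rw [(hd x).deriv]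
    have := (abs_le.1 (hΛ x (interior_subset hx))).2
    linarith
  · intro x hx
    have := (abs_le.1 (hc x (hsub hx))).1
    have : 0 ≤ Λ * (1 - x) := mul_nonneg hΛ0 (by linarith [hx.2])
    linarith
  · exact hcont.integrableOn_Icc.mono_set hsub
  · intro x _ y _ hxy
    have := mul_le_mul_of_nonneg_left hxy hΛ0
    simp only; linarith
  · intro x hx
    have : 0 ≤ Λ * (1 - x) := mul_nonneg hΛ0 (by linarith [hx.2])
    linarith
  · have : Continuous (fun x : ℝ => Λ * (1 - x) + c) := by fun_prop
    exact this.integrableOn_Icc.mono_set hsub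
  · intro x hx
    have h1 := (abs_le.1 (hc x (hsub hx))).2
    have h2 : 0 ≤ Λ * x := mul_nonneg hΛ0 hx.1.le
    constructor <;> simp only <;> linarith
  · have hpi : IntegrableOn (fun x => p.eval x) (Ioc 0 1) :=
      p.continuous.integrableOn_Icc.mono_set hsub
    have e1 : IntegrableOn (fun x => ‖ψ x - u x‖) (Ioc 0 1) := (hψ.sub hu3).norm
    have e2 : IntegrableOn (fun _ : ℝ => ε / 2) (Ioc 0 1) := integrableOn_const (by simp)
    have e3 : IntegrableOn (fun x => |ψ x - ((p.eval x + (Λ * (1 - x) + c)) - (Λ * (1 - x) + c))|)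
        (Ioc 0 1) := by
      simp only [add_sub_cancel_right]
      exact (hψ.sub hpi).norm
    calc _ ≤ ∫ x in Ioc (0:ℝ) 1, (‖ψ x - u x‖ + ε / 2) := by
          refine setIntegral_mono_on e3 (e1.add e2) measurableSet_Ioc ?_
          intro x hx
          have := (hp x (hsub hx)).le
          rw [add_sub_cancel_right, Real.norm_eq_abs]
          have t := abs_add_le (ψ x - u x) (u x - p.eval x)
          rw [sub_add_sub_cancel, abs_sub_comm (u x)] at t
          linarith
      _ ≤ ε := by
          rw [integral_add e1 e2]
          simp only [setIntegral_const]
          simp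
          have : ∫ x in Ioc (0:ℝ) 1, |ψ x - u x| ≤ ε / 2 := by simpa using hu1
          linarith

namespace Br
variable {T S D g : ℝ → ℝ} (h : Br T S D g)
include h

lemma lower {φ : ℝ → ℝ} (hφ : Good φ) (K ε : ℝ) (hK : 0 < K) (hε : 0 < ε) :
    ∃ N : ℕ, ∃ a : ℝ, 0 < a ∧ ∀ f : ℝ → ℝ, Good f → (∀ x ∈ Ioc (0:ℝ) 1, f x ≤ K * φ x) →
      ε ≤ ∫ x in Ioc 0 1, f x → ∀ x ∈ Ioc (0:ℝ) 1, a ≤ (PF D g)^[N] f x := by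
  have h1m : (1:ℝ) ∈ Ioc (0:ℝ) 1 := ⟨by norm_num, le_rfl⟩
  obtain ⟨η, hη0, hη1, hη⟩ : ∃ η : ℝ, 0 < η ∧ η ≤ 1 ∧ ∫ x in Ioc 0 η, φ x ≤ ε / (2 * K) := by
    have ht := tendsto_setIntegral_of_antitone (μ := volume) (f := φ)
      (s := fun n : ℕ => Ioc (0:ℝ) (1 / ((n:ℝ) + 1)))
      (fun _ => measurableSet_Ioc)
      (fun m n hmn => Ioc_subset_Ioc_right (Nat.one_div_le_one_div hmn)) ⟨0, by simpa using hφ.int⟩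
    have he : (⋂ n : ℕ, Ioc (0:ℝ) (1 / ((n:ℝ) + 1))) = ∅ := by
      ext x
      simp only [mem_iInter, mem_empty_iff_false, iff_false, not_forall]
      by_cases hx : 0 < x
      · obtain ⟨n, hn⟩ := exists_nat_one_div_lt hx
        exact ⟨n, fun hc => by linarith [hc.2]⟩
      · exact ⟨0, fun hc => hx hc.1⟩
    rw [he, setIntegral_empty] at ht
    obtain ⟨n, hn⟩ := ((tendsto_order.1 ht).2 (ε / (2 * K)) (by positivity)).exists
    refine ⟨1 / ((n:ℝ) + 1), by positivity, ?_, hn.le⟩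
    rw [div_le_one (by positivity)]
    have : (0:ℝ) ≤ n := Nat.cast_nonneg n
    linarith
  obtain ⟨k, hk⟩ := h.g_iter η hη0
  have hD := h.D_pos (x := 1/2) ⟨by norm_num, le_rfl⟩
  refine ⟨k, ε / 2 / D (1/2) ^ k, by positivity, ?_⟩
  intro f hf hfK hm x hx
  have h1 := h.iter_ge hf k h1m
  have h2 := (h.iter_good hf k).anti hx h1m hx.2
  have h3 := hf.anti h1.1 ⟨hη0, hη1⟩ hk
  have h4 : ε / 2 ≤ f η := by
    have a1 := hf.split le_rfl hη0.le hη1 le_rfl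
    have a2 := hf.le_mul hη0 hη1 le_rfl
    have a3 : ∫ x in Ioc 0 η, f x ≤ ∫ x in Ioc 0 η, K * φ x := by
      refine setIntegral_mono_on (hf.intOn le_rfl hη1) ((hφ.intOn le_rfl hη1).const_mul K)
        measurableSet_Ioc fun x hx => hfK x ⟨hx.1, hx.2.trans hη1⟩
    rw [integral_const_mul] at a3
    have a4 : K * ∫ x in Ioc 0 η, φ x ≤ K * (ε / (2 * K)) := by gcongr
    have a5 : K * (ε / (2 * K)) = ε / 2 := by field_simp
    have a6 := hf.nn η ⟨hη0, hη1⟩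
    nlinarith
  calc ε / 2 / D (1/2) ^ k ≤ f (g^[k] 1) / D (1/2) ^ k := by gcongr; linarith
    _ ≤ _ := h1.2.trans h2

lemma iter_le {φ : ℝ → ℝ} (hP : ∀ y ∈ Ioc (0:ℝ) 1, PF D g φ y = φ y) {K : ℝ} {f : ℝ → ℝ}
    (hf : ∀ x ∈ Ioc (0:ℝ) 1, f x ≤ K * φ x) (n : ℕ) :
    ∀ x ∈ Ioc (0:ℝ) 1, (PF D g)^[n] f x ≤ K * φ x := by
  induction n with
  | zero => exact hf
  | succ n ih =>
    intro x hx
    rw [Function.iterate_succ_apply']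
    refine (h.PF_mono ih x hx).trans ?_
    have := hP x hx
    rw [← this]
    apply le_of_eq
    simp only [PF]; ring

lemma Tn_meas (n : ℕ) : Measurable T^[n] := h.T_meas.iterate n

lemma coupling {φ : ℝ → ℝ} (hφ : Good φ) (hP : ∀ y ∈ Ioc (0:ℝ) 1, PF D g φ y = φ y)
    (K ε : ℝ) (hK : 0 < K) (hε : 0 < ε) (f f' : ℝ → ℝ) (hf : Good f) (hf' : Good f')
    (hfK : ∀ x ∈ Ioc (0:ℝ) 1, f x ≤ K * φ x) (hfK' : ∀ x ∈ Ioc (0:ℝ) 1, f' x ≤ K * φ x)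
    (hm : ∫ x in Ioc 0 1, f x = ∫ x in Ioc 0 1, f' x) :
    ∃ n : ℕ, ∀ A : Set ℝ, MeasurableSet A →
      |(∫ x in T^[n] ⁻¹' A ∩ Ioc 0 1, f x) - ∫ x in T^[n] ⁻¹' A ∩ Ioc 0 1, f' x| ≤ ε := by
  obtain ⟨N, a, ha, hlow⟩ := h.lower hφ K ε hK hε
  obtain ⟨j, hj⟩ : ∃ j : ℕ, ∫ x in Ioc 0 1, f x ≤ ε + j * a := by
    obtain ⟨j, hj⟩ := exists_nat_ge ((∫ x in Ioc 0 1, f x) / a)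
    rw [div_le_iff₀ ha] at hj
    exact ⟨j, by linarith⟩
  have base : ∀ f f' : ℝ → ℝ, Good f → Good f' → 
      (∫ x in Ioc 0 1, f x = ∫ x in Ioc 0 1, f' x) → (∫ x in Ioc 0 1, f x ≤ ε) →
      ∃ n : ℕ, ∀ A : Set ℝ, MeasurableSet A →
      |(∫ x in T^[n] ⁻¹' A ∩ Ioc 0 1, f x) - ∫ x in T^[n] ⁻¹' A ∩ Ioc 0 1, f' x| ≤ ε := by
    intro f f' hf hf' hm hle
    refine ⟨0, fun A hA => ?_⟩
    have hMI : MeasurableSet (A ∩ Ioc (0:ℝ) 1) := hA.inter measurableSet_Ioc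
    have aux : ∀ f : ℝ → ℝ, Good f → 0 ≤ ∫ x in A ∩ Ioc 0 1, f x ∧
        ∫ x in A ∩ Ioc 0 1, f x ≤ ∫ x in Ioc 0 1, f x := by
      intro f hf
      refine ⟨setIntegral_nonneg hMI fun x hx => hf.nn x hx.2, ?_⟩
      refine setIntegral_mono_set hf.int ?_ (LE.le.eventuallyLE inter_subset_right)
      filter_upwards [ae_restrict_mem measurableSet_Ioc] with x hx using hf.nn x hx
    have b1 := aux f hf
    have b2 := aux f' hf'
    simp only [Function.iterate_zero, preimage_id]
    rw [abs_le]
    constructor <;> linarith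
  induction j generalizing f f' with
  | zero => exact base f f' hf hf' hm (by simpa using hj)
  | succ j ih =>
    by_cases hle : ∫ x in Ioc 0 1, f x ≤ ε
    · exact base f f' hf hf' hm hle
    push Not at hle
    have hmk : ∀ f : ℝ → ℝ, Good f → (∀ x ∈ Ioc (0:ℝ) 1, f x ≤ K * φ x) →
        (ε ≤ ∫ x in Ioc 0 1, f x) → Good (fun x => (PF D g)^[N] f x - a) ∧
        (∀ x ∈ Ioc (0:ℝ) 1, (PF D g)^[N] f x - a ≤ K * φ x) ∧
        ∫ x in Ioc 0 1, ((PF D g)^[N] f x - a) = (∫ x in Ioc 0 1, f x) - a := by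
      intro f hf hfK hm
      have hg := h.iter_good hf N
      refine ⟨⟨?_, ?_, ?_⟩, ?_, ?_⟩
      · intro x hx y hy hxy
        have := hg.anti hx hy hxy
        simp only; linarith
      · intro x hx
        have := hlow f hf hfK hm x hx
        linarith
      · exact hg.int.sub (integrableOn_const (by simp))
      · intro x hx
        linarith [h.iter_le hP hfK N x hx]
      · rw [integral_sub hg.int (integrableOn_const (by simp)), h.iter_total hf]
        simp
    obtain ⟨u1, u2, u3⟩ := hmk f hf hfK hle.le
    obtain ⟨v1, v2, v3⟩ := hmk f' hf' hfK' (hm ▸ hle.le)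
    obtain ⟨n, hn⟩ := ih _ _ u1 v1 u2 v2 (by rw [u3, v3, hm]) (by rw [u3]; push_cast at hj; linarith)
    refine ⟨N + n, fun A hA => ?_⟩
    have hB : MeasurableSet (T^[n] ⁻¹' A) := h.Tn_meas n hA
    have := hn A hA
    have aux : ∀ f : ℝ → ℝ, Good f → 
        ∫ x in T^[n] ⁻¹' A ∩ Ioc 0 1, ((PF D g)^[N] f x - a) =
        (∫ x in T^[N + n] ⁻¹' A ∩ Ioc 0 1, f x) - ∫ x in T^[n] ⁻¹' A ∩ Ioc 0 1, a := by
      intro f hf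
      rw [integral_sub ((h.iter_good hf N).int.mono_set inter_subset_right)
        ((integrableOn_const (s := Ioc (0:ℝ) 1) (by simp)).mono_set inter_subset_right),
        h.iter_dual hB hf, ← preimage_comp, ← Function.iterate_add, add_comm n N]
    rw [aux f hf, aux f' hf'] at this
    simpa using this

/-- uniqueness at the level of densities -/
lemma unique {φ : ℝ → ℝ} (hφ : Good φ) (hφ1 : 0 < φ 1)
    (hP : ∀ y ∈ Ioc (0:ℝ) 1, PF D g φ y = φ y) (hφm : ∫ x in Ioc 0 1, φ x = 1)
    {ψ : ℝ → ℝ} (hψ : IntegrableOn ψ (Ioc 0 1)) (hψm : ∫ x in Ioc 0 1, ψ x = 1)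
    (hinv : ∀ A : Set ℝ, MeasurableSet A →
      ∫ x in T ⁻¹' A ∩ Ioc 0 1, ψ x = ∫ x in A ∩ Ioc 0 1, ψ x)
    (A : Set ℝ) (hA : MeasurableSet A) :
    ∫ x in A ∩ Ioc 0 1, ψ x = ∫ x in A ∩ Ioc 0 1, φ x := by
  have hinvn : ∀ n, ∀ A : Set ℝ, MeasurableSet A →
      ∫ x in T^[n] ⁻¹' A ∩ Ioc 0 1, ψ x = ∫ x in A ∩ Ioc 0 1, ψ x := by
    intro n
    induction n with
    | zero => intro A _; rfl
    | succ n ih =>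
      intro A hA
      rw [Function.iterate_succ', preimage_comp, ih _ (h.T_meas hA), hinv A hA]
  have hitφ : ∀ n, ∀ x ∈ Ioc (0:ℝ) 1, (PF D g)^[n] φ x = φ x := by
    intro n
    induction n with
    | zero => intro x _; rfl
    | succ n ih =>
      intro x hx
      rw [Function.iterate_succ_apply', ← hP x hx]
      simp only [PF]
      rw [ih _ (h.g_mem1 hx), ih _ (h.half_mem hx)]
  have hinvφ : ∀ n, ∫ x in T^[n] ⁻¹' A ∩ Ioc 0 1, φ x = ∫ x in A ∩ Ioc 0 1, φ x := by
    intro n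
    rw [← h.iter_dual hA hφ n]
    exact setIntegral_congr_fun (hA.inter measurableSet_Ioc) fun x hx => hitφ n x hx.2
  have hφA : |∫ x in A ∩ Ioc 0 1, φ x| ≤ 1 := by
    rw [abs_of_nonneg (setIntegral_nonneg (hA.inter measurableSet_Ioc) fun x hx => hφ.nn x hx.2)]
    refine le_trans ?_ hφm.le
    refine setIntegral_mono_set hφ.int ?_ (LE.le.eventuallyLE inter_subset_right)
    filter_upwards [ae_restrict_mem measurableSet_Ioc] with x hx using hφ.nn x hx
  have main : ∀ ε : ℝ, 0 < ε → ε < 1 →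
      |(∫ x in A ∩ Ioc 0 1, ψ x) - ∫ x in A ∩ Ioc 0 1, φ x| ≤ 3 * ε := by
    intro ε hε hε1
    obtain ⟨f1, f2, C, g1, g2, hC, hap⟩ := approx_good hψ hε
    have hdiff : IntegrableOn (fun x => f1 x - f2 x) (Ioc 0 1) := g1.int.sub g2.int
    have herr : ∀ B : Set ℝ, MeasurableSet B → 
        |(∫ x in B ∩ Ioc 0 1, ψ x) - ((∫ x in B ∩ Ioc 0 1, f1 x) - ∫ x in B ∩ Ioc 0 1, f2 x)| ≤ ε := by
      intro B hB
      have i1 := hψ.mono_set (inter_subset_right (s := B))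
      have i2 := g1.int.mono_set (inter_subset_right (s := B))
      have i3 := g2.int.mono_set (inter_subset_right (s := B))
      have i4 : IntegrableOn (fun x => f1 x - f2 x) (B ∩ Ioc 0 1) := i2.sub i3
      rw [← integral_sub i2 i3, ← integral_sub i1 i4]
      refine (abs_integral_le_integral_abs).trans (le_trans ?_ hap)
      refine setIntegral_mono_set (hψ.sub hdiff).norm ?_
        (LE.le.eventuallyLE inter_subset_right)
      exact Eventually.of_forall fun x => abs_nonneg _
    set m := (∫ x in Ioc 0 1, f1 x) - ∫ x in Ioc 0 1, f2 x with hmdef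
    have hm1 : |1 - m| ≤ ε := by
      have := herr univ MeasurableSet.univ
      simpa [hψm] using this
    have hm0 : 0 ≤ m := by linarith [(abs_le.1 hm1).2]
    have hC0 : 0 ≤ C := (g1.nn 1 ⟨one_pos, le_rfl⟩).trans (hC 1 ⟨one_pos, le_rfl⟩).1
    have hge : ∀ x ∈ Ioc (0:ℝ) 1, C ≤ C / φ 1 * φ x := by
      intro x hx
      have := hφ.anti hx ⟨one_pos, le_rfl⟩ hx.2
      calc C = C / φ 1 * φ 1 := by field_simp
        _ ≤ _ := by gcongr
    have gm := hφ.smul hm0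
    obtain ⟨n, hn⟩ := h.coupling hφ hP (C / φ 1 + m + 1) ε (by positivity) hε f1
      (fun x => f2 x + m * φ x) g1 (g2.add gm)
      (fun x hx => by
        have := hge x hx
        have := (hC x hx).1
        have := mul_nonneg hm0 (hφ.nn x hx)
        have := hφ.nn x hx
        linarith)
      (fun x hx => by
        have := hge x hx
        have := (hC x hx).2
        have := hφ.nn x hx
        linarith)
      (by
        rw [integral_add g2.int gm.int, integral_const_mul, hφm]
        linarith)
    have hB : MeasurableSet (T^[n] ⁻¹' A) := h.Tn_meas n hA
    have e1 := hn A hA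
    have e2 := herr _ hB
    rw [integral_add (g2.int.mono_set inter_subset_right) (gm.int.mono_set inter_subset_right),
      integral_const_mul, hinvφ n] at e1
    rw [hinvn n A hA] at e2
    set X := ∫ x in A ∩ Ioc 0 1, φ x
    have e3 : |(m - 1) * X| ≤ ε := by
      rw [abs_mul, abs_sub_comm]
      calc |1 - m| * |X| ≤ ε * 1 := by gcongr
        _ = ε := mul_one _
    rw [abs_le] at e1 e2 e3 ⊢
    constructor <;> linarith
  by_contra hne
  have hpos : 0 < |(∫ x in A ∩ Ioc 0 1, ψ x) - ∫ x in A ∩ Ioc 0 1, φ x| :=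
    abs_pos.2 (sub_ne_zero.2 hne)
  set d := |(∫ x in A ∩ Ioc 0 1, ψ x) - ∫ x in A ∩ Ioc 0 1, φ x|
  have := main (min (d / 6) (1/2)) (by positivity) (lt_of_le_of_lt (min_le_right _ _) (by norm_num))
  have := min_le_left (d / 6) (1/2)
  linarith

/-- the abstract conclusion -/
lemma abstract_main : ∃ ν : Measure ℝ, ∃ φ : ℝ → ℝ,
      (IsProbabilityMeasure ν ∧ ν (Set.Icc (0 : ℝ) 1)ᶜ = 0 ∧ ν ≪ volume ∧
        (∀ A : Set ℝ, MeasurableSet A → ν (T ⁻¹' A) = ν A)) ∧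
      (∀ ν' : Measure ℝ,
        (IsProbabilityMeasure ν' ∧ ν' (Set.Icc (0 : ℝ) 1)ᶜ = 0 ∧ ν' ≪ volume ∧
          (∀ A : Set ℝ, MeasurableSet A → ν' (T ⁻¹' A) = ν' A)) → ν' = ν) ∧
      ν = (volume.restrict (Set.Icc (0 : ℝ) 1)).withDensity (fun x => ENNReal.ofReal (φ x)) ∧
      (∃ c0 : ℝ, 0 < c0 ∧ ∀ x ∈ Set.Icc (0 : ℝ) 1, c0 ≤ φ x) ∧
      (∀ ε : ℝ, 0 < ε → ∃ M : ℝ, ∀ x ∈ Set.Icc ε 1, φ x ≤ M) ∧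
      (∃ a b : ℝ, 0 < a ∧ 0 < b ∧ (∀ y ∈ Ioc (0:ℝ) 1, φ y * (y - g y) ≤ b * y) ∧
        (∀ x ∈ Ioc (0:ℝ) (1/2), a * S x ≤ φ x * (S x - x))) := by
  obtain ⟨φ, hφ, hφ1, hP, hφm⟩ := h.exists_density
  have h1m : (1:ℝ) ∈ Ioc (0:ℝ) 1 := ⟨by norm_num, le_rfl⟩
  have hrest : (volume.restrict (Icc (0:ℝ) 1)) = volume.restrict (Ioc (0:ℝ) 1) :=
    Measure.restrict_congr_set Ioc_ae_eq_Icc.symm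
  let φ' : ℝ → ℝ := fun x => if 0 < x then φ x else φ 1
  have hφφ' : ∀ x ∈ Ioc (0:ℝ) 1, φ' x = φ x := fun x hx => if_pos hx.1
  let ν : Measure ℝ := (volume.restrict (Icc (0:ℝ) 1)).withDensity (fun x => ENNReal.ofReal (φ' x))
  have hν : ∀ A : Set ℝ, MeasurableSet A → ν A = ENNReal.ofReal (∫ x in A ∩ Ioc 0 1, φ x) := by
    intro A hA
    simp only [ν]
    rw [hrest, withDensity_apply _ hA, Measure.restrict_restrict hA,
      ofReal_integral_eq_lintegral_ofReal (hφ.int.mono_set inter_subset_right)]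
    · exact setLIntegral_congr_fun (hA.inter measurableSet_Ioc)
        fun x hx => by simp only [hφφ' x hx.2]
    · filter_upwards [ae_restrict_mem (hA.inter measurableSet_Ioc)] with x hx using hφ.nn x hx.2
  refine ⟨ν, φ', ⟨⟨?_⟩, ?_, ?_, ?_⟩, ?_, rfl, ⟨φ 1, hφ1, ?_⟩, ?_, ?_⟩
  · rw [hν _ MeasurableSet.univ, univ_inter, hφm, ENNReal.ofReal_one]
  · rw [hν _ measurableSet_Icc.compl]
    have : (Icc (0:ℝ) 1)ᶜ ∩ Ioc 0 1 = ∅ := by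
      rw [← disjoint_iff_inter_eq_empty]
      exact disjoint_compl_left.mono_right Ioc_subset_Icc_self
    rw [this]; simp
  · exact (withDensity_absolutelyContinuous _ _).trans Measure.restrict_le_self.absolutelyContinuous
  · intro A hA
    rw [hν _ hA, hν _ (h.T_meas hA), ← h.dual hA hφ.int]
    congr 1
    exact setIntegral_congr_fun (hA.inter measurableSet_Ioc) fun x hx => hP x hx.2
  · rintro ν' ⟨hpr, hsupp, hac, hinv⟩
    let ψ : ℝ → ℝ := fun x => (ν'.rnDeriv volume x).toReal
    have hnull : ν' (Ioc (0:ℝ) 1)ᶜ = 0 := by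
      have e : (Ioc (0:ℝ) 1)ᶜ ⊆ (Icc (0:ℝ) 1)ᶜ ∪ {0} := by
        intro x hx
        by_cases h0 : x = 0
        · right; exact h0
        · left; intro hc; exact hx ⟨lt_of_le_of_ne hc.1 (Ne.symm h0), hc.2⟩
      refine measure_mono_null e (measure_union_null hsupp (hac (by simp)))
    have hψi : Integrable ψ volume := Measure.integrable_toReal_rnDeriv
    have hψ : ∀ A : Set ℝ, MeasurableSet A → ∫ x in A ∩ Ioc 0 1, ψ x = (ν' A).toReal := by
      intro A hA
      have : ∫ x in A ∩ Ioc 0 1, ψ x = (ν' (A ∩ Ioc 0 1)).toReal := by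
        simp only [ψ]
        rw [Measure.setIntegral_toReal_rnDeriv hac]; rfl
      rw [this, measure_inter_conull hnull]
    ext A hA
    have hu := h.unique hφ hφ1 hP hφm hψi.integrableOn
      (by have := hψ univ MeasurableSet.univ; simpa using this)
      (fun A hA => by rw [hψ _ (h.T_meas hA), hψ _ hA, hinv A hA]) A hA
    rw [hν A hA, ← hu, hψ A hA, ENNReal.ofReal_toReal (measure_ne_top _ _)]
  · intro x hx
    simp only [φ']
    split_ifs with h0
    · exact hφ.anti ⟨h0, hx.2⟩ h1m hx.2
    · exact le_rfl
  · intro ε hε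
    refine ⟨φ ε, fun x hx => ?_⟩
    have h0 : 0 < x := hε.trans_le hx.1
    rw [hφφ' x ⟨h0, hx.2⟩]
    exact hφ.anti ⟨hε, hx.1.trans hx.2⟩ ⟨h0, hx.2⟩ hx.1
  · have hkey : ∀ y ∈ Ioc (0:ℝ) 1, ∫ x in Ioc (g y) y, φ x = ∫ x in Ioc (1/2) ((y + 1) / 2), φ x := by
      intro y hy
      have := h.key hφ hy
      have e : ∫ x in Ioc 0 y, PF D g φ x = ∫ x in Ioc 0 y, φ x :=
        setIntegral_congr_fun measurableSet_Ioc fun x hx => hP x ⟨hx.1, hx.2.trans hy.2⟩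
      linarith
    have hpos : 0 < φ (1/2) := hφ1.trans_le (hφ.anti ⟨by norm_num, by norm_num⟩ h1m (by norm_num))
    refine ⟨φ 1 / 2, φ (1/2) / 2, by positivity, by positivity, ?_, ?_⟩
    · intro y hy
      rw [hφφ' y hy]
      have a1 := hφ.ge_mul (h.g_mem y hy).1.le (h.g_lt y hy).le hy.1 hy.2
      have a2 := hφ.le_mul (a := 1/2) (b := (y+1)/2) (by norm_num) (by linarith [hy.1]) (h.half_mem hy).2
      rw [hkey y hy] at a1
      have e : (y + 1) / 2 - 1 / 2 = y / 2 := by ring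
      rw [e] at a2
      linarith
    · intro x hx
      have hy := h.S_mem x hx
      rw [hφφ' x ⟨hx.1, hx.2.trans (by norm_num)⟩]
      have hk := hkey _ hy
      have hlt := h.g_lt _ hy
      rw [h.gS x hx] at hk hlt
      have a1 := hφ.le_mul hx.1 hlt.le hy.2
      have a2 := hφ.ge_mul (a := 1/2) (b := (S x+1)/2) (by norm_num) (by linarith [hy.1])
        (h.half_mem hy).1 (h.half_mem hy).2
      have e : (S x + 1) / 2 - 1 / 2 = S x / 2 := by ring
      rw [e] at a2
      have a3 := hφ.anti (h.half_mem hy) h1m (h.half_mem hy).2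
      have a4 := mul_le_mul_of_nonneg_right a3 (by linarith [hy.1] : 0 ≤ S x / 2)
      linarith

end Br

/-- relative increment of the left branch -/
noncomputable def sfun (c β x : ℝ) : ℝ := c * (-Real.log x) ^ (-β)

noncomputable def Sfun (c β x : ℝ) : ℝ := x * (1 + sfun c β x)

noncomputable def Dfun (c β x : ℝ) : ℝ :=
  1 + sfun c β x + c * β * (-Real.log x) ^ (-β - 1)

noncomputable def gfun (c β : ℝ) : ℝ → ℝ := Function.invFunOn (Sfun c β) (Ioc 0 (1/2))

section concrete
variable {c β : ℝ} (hβ : 0 ≤ β) (hc : c = (Real.log 2) ^ β)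

lemma log2_pos : 0 < Real.log 2 := Real.log_pos one_lt_two

lemma L_ge {x : ℝ} (hx : x ∈ Ioc (0:ℝ) (1/2)) : Real.log 2 ≤ -Real.log x := by
  have := Real.log_le_log hx.1 hx.2
  rw [one_div, Real.log_inv] at this
  linarith

lemma L_pos {x : ℝ} (hx : x ∈ Ioc (0:ℝ) (1/2)) : 0 < -Real.log x :=
  log2_pos.trans_le (L_ge hx)

include hc in
lemma c_pos : 0 < c := hc ▸ Real.rpow_pos_of_pos log2_pos β

include hc in
lemma s_pos {x : ℝ} (hx : x ∈ Ioc (0:ℝ) (1/2)) : 0 < sfun c β x :=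
  mul_pos (c_pos hc) (Real.rpow_pos_of_pos (L_pos hx) _)

include hβ hc in
lemma s_mono : MonotoneOn (sfun c β) (Ioc 0 (1/2)) := by
  intro x hx y hy hxy
  have := Real.log_le_log hx.1 hxy
  exact mul_le_mul_of_nonneg_left
    (Real.rpow_le_rpow_of_nonpos (L_pos hy) (by linarith) (by linarith)) (c_pos hc).le

include hc in
lemma s_half : sfun c β (1/2) = 1 := by
  rw [sfun, one_div, Real.log_inv, neg_neg, hc, ← Real.rpow_add log2_pos]
  simp

include hβ hc in
lemma s_le {x : ℝ} (hx : x ∈ Ioc (0:ℝ) (1/2)) : sfun c β x ≤ 1 := by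
  rw [← s_half hc]
  exact s_mono hβ hc hx ⟨by norm_num, le_rfl⟩ hx.2

include hβ hc in
lemma S_strict : StrictMonoOn (Sfun c β) (Ioc 0 (1/2)) := by
  intro x hx y hy hxy
  have h1 := s_mono hβ hc hx hy hxy.le
  have h2 := s_pos hc hx
  have h3 := hx.1
  have h4 := hy.1
  unfold Sfun
  calc x * (1 + sfun c β x) < y * (1 + sfun c β x) := by gcongr
    _ ≤ _ := by gcongr

include hc in
lemma S_half : Sfun c β (1/2) = 1 := by rw [Sfun, s_half hc]; norm_num

include hβ hc in
lemma S_memI {x : ℝ} (hx : x ∈ Ioc (0:ℝ) (1/2)) : Sfun c β x ∈ Ioc (0:ℝ) 1 := by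
  have h1 := s_pos hc hx
  have h2 := s_le hβ hc hx
  have h3 := hx.1
  have h4 := hx.2
  refine ⟨by unfold Sfun; positivity, ?_⟩
  unfold Sfun; nlinarith

include hc in
lemma S_hasDeriv {x : ℝ} (hx : x ∈ Ioc (0:ℝ) (1/2)) : HasDerivAt (Sfun c β) (Dfun c β x) x := by
  have h0 : x ≠ 0 := hx.1.ne'
  have h1 : HasDerivAt (fun x => -Real.log x) (-x⁻¹) x := (Real.hasDerivAt_log h0).neg
  have h2 := (h1.rpow_const (p := -β) (Or.inl (L_pos hx).ne')).const_mul c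
  have h3 := (hasDerivAt_id x).mul (h2.const_add 1)
  refine HasDerivAt.congr_deriv (f := Sfun c β) h3 ?_
  simp only [Dfun, sfun, id]
  field_simp

include hβ hc in
lemma D_ge1 {x : ℝ} (hx : x ∈ Ioc (0:ℝ) (1/2)) : 1 ≤ Dfun c β x := by
  have h1 := s_pos hc hx
  have h2 : 0 ≤ c * β * (-Real.log x) ^ (-β - 1) :=
    mul_nonneg (mul_nonneg (c_pos hc).le hβ) (Real.rpow_nonneg (L_pos hx).le _)
  unfold Dfun; linarith

include hβ hc in
lemma D_monoI : MonotoneOn (Dfun c β) (Ioc 0 (1/2)) := by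
  intro x hx y hy hxy
  have h1 := s_mono hβ hc hx hy hxy
  have := Real.log_le_log hx.1 hxy
  have h2 : c * β * (-Real.log x) ^ (-β - 1) ≤ c * β * (-Real.log y) ^ (-β - 1) :=
    mul_le_mul_of_nonneg_left
      (Real.rpow_le_rpow_of_nonpos (L_pos hy) (by linarith) (by linarith))
      (mul_nonneg (c_pos hc).le hβ)
  unfold Dfun; linarith

include hβ hc in
lemma S_surj {y : ℝ} (hy : y ∈ Ioc (0:ℝ) 1) : ∃ x ∈ Ioc (0:ℝ) (1/2), Sfun c β x = y := by
  have hm : y / 2 ∈ Ioc (0:ℝ) (1/2) := ⟨by linarith [hy.1], by linarith [hy.2]⟩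
  have hcont : ContinuousOn (Sfun c β) (Icc (y/2) (1/2)) := fun x hx =>
    (S_hasDeriv hc (x := x) ⟨hm.1.trans_le hx.1, hx.2⟩).continuousAt.continuousWithinAt
  have h1 : Sfun c β (y/2) ≤ y := by
    have := s_le hβ hc hm
    have := hm.1
    unfold Sfun; nlinarith
  have := intermediate_value_Icc hm.2 hcont ⟨h1, by rw [S_half hc]; exact hy.2⟩
  obtain ⟨x, hx, e⟩ := this
  exact ⟨x, ⟨hm.1.trans_le hx.1, hx.2⟩, e⟩

include hβ hc in
lemma g_memI {y : ℝ} (hy : y ∈ Ioc (0:ℝ) 1) : gfun c β y ∈ Ioc (0:ℝ) (1/2) :=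
  Function.invFunOn_mem (S_surj hβ hc hy)

include hβ hc in
lemma Sg_eq {y : ℝ} (hy : y ∈ Ioc (0:ℝ) 1) : Sfun c β (gfun c β y) = y :=
  Function.invFunOn_eq (S_surj hβ hc hy)

include hβ hc in
lemma gS_eq {x : ℝ} (hx : x ∈ Ioc (0:ℝ) (1/2)) : gfun c β (Sfun c β x) = x :=
  (S_strict hβ hc).injOn (g_memI hβ hc (S_memI hβ hc hx)) hx (Sg_eq hβ hc (S_memI hβ hc hx))

include hβ hc in
lemma g_ltI {y : ℝ} (hy : y ∈ Ioc (0:ℝ) 1) : gfun c β y < y := by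
  have h1 := g_memI hβ hc hy
  have h2 := Sg_eq hβ hc hy
  have h3 := s_pos hc h1
  have h4 := h1.1
  unfold Sfun at h2
  nlinarith

include hβ hc in
lemma g_half_le {y : ℝ} (hy : y ∈ Ioc (0:ℝ) 1) : y / 2 ≤ gfun c β y := by
  have h1 := g_memI hβ hc hy
  have h2 := Sg_eq hβ hc hy
  have h3 := s_le hβ hc h1
  have h4 := h1.1
  unfold Sfun at h2
  nlinarith

include hβ hc in
lemma g_ratio {y : ℝ} (hy : y ∈ Ioc (0:ℝ) 1) :
    y / (y - gfun c β y) ≤ 2 / c * (-Real.log (y / 2)) ^ β := by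
  have h1 := g_memI hβ hc hy
  have h2 := Sg_eq hβ hc hy
  have h3 := s_le hβ hc h1
  have h4 := h1.1
  have h5 := s_pos hc h1
  have h6 := g_half_le hβ hc hy
  have hm : y / 2 ∈ Ioc (0:ℝ) (1/2) := ⟨by linarith [hy.1], by linarith [hy.2]⟩
  have hcp := c_pos hc
  set x := gfun c β y
  have h7 : y - x = x * sfun c β x := by rw [← h2, Sfun]; ring
  have h8 : y / (y - x) ≤ 2 / sfun c β x := by
    rw [h7, div_le_div_iff₀ (by positivity) h5]
    nlinarith [hy.1]
  refine h8.trans ?_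
  have hlog := Real.log_le_log hm.1 h6
  have hL := L_pos h1
  have h9 : 2 / sfun c β x = 2 / c * (-Real.log x) ^ β := by
    rw [sfun, Real.rpow_neg hL.le]
    have := Real.rpow_pos_of_pos hL β
    field_simp
  rw [h9]
  gcongr

include hβ hc in
lemma g_iterI (η : ℝ) (hη : 0 < η) : ∃ k : ℕ, (gfun c β)^[k] 1 ≤ η := by
  by_contra hcon
  push Not at hcon
  have hη' : min η (1/2) ∈ Ioc (0:ℝ) (1/2) := ⟨by positivity, min_le_right _ _⟩
  set κ := sfun c β (min η (1/2)) with hκ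
  have hκ0 : 0 < κ := s_pos hc hη'
  have hmem : ∀ k : ℕ, (gfun c β)^[k] 1 ∈ Ioc (0:ℝ) 1 := by
    intro k
    induction k with
    | zero => exact ⟨one_pos, le_rfl⟩
    | succ k ih =>
      rw [Function.iterate_succ_apply']
      have := g_memI hβ hc ih
      exact ⟨this.1, this.2.trans (by norm_num)⟩
  have hb : ∀ k : ℕ, (gfun c β)^[k] 1 * (1 + κ) ^ k ≤ 1 := by
    intro k
    induction k with
    | zero => simp
    | succ k ih =>
      refine le_trans ?_ ih
      have e := Sg_eq hβ hc (hmem k)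
      have m := g_memI hβ hc (hmem k)
      have hgt := hcon (k+1)
      rw [Function.iterate_succ_apply'] at hgt ⊢
      have hs : κ ≤ sfun c β (gfun c β ((gfun c β)^[k] 1)) :=
        s_mono hβ hc hη' m ((min_le_left _ _).trans hgt.le)
      have m1 := m.1
      rw [pow_succ', ← mul_assoc]
      gcongr
      nth_rewrite 2 [← e]
      unfold Sfun
      gcongr
  obtain ⟨n, hn⟩ := pow_unbounded_of_one_lt (1 / η) (by linarith : 1 < 1 + κ)
  have h1 := hb n
  have h2 := hcon n
  rw [div_lt_iff₀ hη] at hn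
  have : (1 + κ) ^ n * η ≤ (1 + κ) ^ n * (gfun c β)^[n] 1 := by gcongr
  linarith

include hβ hc in
lemma g_bdI : ∃ C r : ℝ, r < 1 ∧ ∀ y ∈ Ioc (0:ℝ) 1, y / (y - gfun c β y) ≤ C * y ^ (-r) := by
  have hcp := c_pos hc
  set ε := 1 / (β + 1) with hε
  have hε0 : 0 < ε := by positivity
  refine ⟨2 / c * ((2 ^ ε / ε) ^ β), ε * β, ?_, ?_⟩
  · rw [hε, one_div, inv_mul_eq_div, div_lt_one (by positivity)]; linarith
  · intro y hy
    refine (g_ratio hβ hc hy).trans ?_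
    have hm : y / 2 ∈ Ioc (0:ℝ) (1/2) := ⟨by linarith [hy.1], by linarith [hy.2]⟩
    have hy0 := hy.1
    rw [mul_assoc]
    have h1 : -Real.log (y / 2) ≤ 2 ^ ε / ε * y ^ (-ε) := by
      rw [← Real.log_inv, inv_div]
      refine (Real.log_le_rpow_div (by positivity) hε0).trans (le_of_eq ?_)
      rw [Real.div_rpow (by norm_num) hy0.le, Real.rpow_neg hy0.le]
      field_simp
    have h2 : (-Real.log (y / 2)) ^ β ≤ (2 ^ ε / ε * y ^ (-ε)) ^ β :=
      Real.rpow_le_rpow (L_pos hm).le h1 hβ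
    rw [Real.mul_rpow (by positivity) (by positivity), ← Real.rpow_mul hy0.le, neg_mul] at h2
    gcongr

end concrete

lemma Tmap_left {γ x : ℝ} (hx : x ∈ Ioc (0:ℝ) (1/2)) :
    Tmap γ x = Sfun (Real.log 2 ^ (1 / γ - 1)) (1 / γ - 1) x := by
  have hL := L_pos hx
  rw [Tmap, if_neg (not_le.2 hx.1), if_pos hx.2, Sfun, sfun, Real.rpow_neg hL.le, abs_of_neg (by linarith)]
  rfl

lemma Tmap_br {γ : ℝ} (hγ0 : 0 < γ) (hγ1 : γ ≤ 1) :
    Br (Tmap γ) (Sfun (Real.log 2 ^ (1 / γ - 1)) (1 / γ - 1))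
      (Dfun (Real.log 2 ^ (1 / γ - 1)) (1 / γ - 1))
      (gfun (Real.log 2 ^ (1 / γ - 1)) (1 / γ - 1)) := by
  have hβ : 0 ≤ 1 / γ - 1 := by
    rw [sub_nonneg, le_div_iff₀ hγ0]; linarith
  refine ⟨?_, fun x hx => Tmap_left hx, ?_, fun y hy => g_memI hβ rfl hy,
    fun x hx => S_memI hβ rfl hx, fun y hy => Sg_eq hβ rfl hy, fun x hx => gS_eq hβ rfl hx, ?_,
    fun y hy => g_ltI hβ rfl hy, fun x hx => S_hasDeriv rfl hx, fun x hx => D_ge1 hβ rfl hx,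
    D_monoI hβ rfl, g_iterI hβ rfl, g_bdI hβ rfl⟩
  · unfold Tmap
    refine Measurable.ite measurableSet_Iic measurable_const
      (Measurable.ite measurableSet_Iic ?_ (by fun_prop))
    refine measurable_id.mul (measurable_const.add (measurable_const.div ?_))
    exact (Real.measurable_log.abs).pow_const _
  · intro x hx
    rw [Tmap, if_neg (by linarith [hx.1]), if_neg (by linarith [hx.1])]
  · intro x hx y hy hxy
    by_contra hcon
    push Not at hcon
    have := S_strict hβ rfl (g_memI hβ rfl hy) (g_memI hβ rfl hx) hcon
    rw [Sg_eq hβ rfl hx, Sg_eq hβ rfl hy] at this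
    linarith

/-- There is a unique `T`-invariant Borel probability measure `ν` on `[0,1]` absolutely
continuous w.r.t. Lebesgue measure; moreover a version `φ` of its density is bounded below
by a strictly positive constant on `[0,1]`, bounded above on every `[ε, 1]`, and satisfies
`c1 ≤ |log x|^{-β} φ(x) ≤ c2` on some `(0, δ]`, where `β = 1/γ - 1`. -/
theorem stmt3 (γ : ℝ) (hγ0 : 0 < γ) (hγ1 : γ ≤ 1) :
    ∃ ν : Measure ℝ, ∃ φ : ℝ → ℝ,
      (IsProbabilityMeasure ν ∧ ν (Set.Icc (0 : ℝ) 1)ᶜ = 0 ∧ ν ≪ volume ∧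
        (∀ A : Set ℝ, MeasurableSet A → ν (Tmap γ ⁻¹' A) = ν A)) ∧
      (∀ ν' : Measure ℝ,
        (IsProbabilityMeasure ν' ∧ ν' (Set.Icc (0 : ℝ) 1)ᶜ = 0 ∧ ν' ≪ volume ∧
          (∀ A : Set ℝ, MeasurableSet A → ν' (Tmap γ ⁻¹' A) = ν' A)) → ν' = ν) ∧
      ν = (volume.restrict (Set.Icc (0 : ℝ) 1)).withDensity (fun x => ENNReal.ofReal (φ x)) ∧
      (∃ c0 : ℝ, 0 < c0 ∧ ∀ x ∈ Set.Icc (0 : ℝ) 1, c0 ≤ φ x) ∧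
      (∀ ε : ℝ, 0 < ε → ∃ M : ℝ, ∀ x ∈ Set.Icc ε 1, φ x ≤ M) ∧
      (∃ δ : ℝ, 0 < δ ∧ ∃ c1 c2 : ℝ, 0 < c1 ∧ 0 < c2 ∧
        ∀ x ∈ Set.Ioc (0 : ℝ) δ,
          c1 ≤ |Real.log x| ^ (-(1 / γ - 1)) * φ x ∧
          |Real.log x| ^ (-(1 / γ - 1)) * φ x ≤ c2) := by
  have hβ : 0 ≤ 1 / γ - 1 := by
    rw [sub_nonneg, le_div_iff₀ hγ0]; linarith
  have hbr := Tmap_br hγ0 hγ1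
  obtain ⟨ν, φ, p1, p2, p3, p4, p5, a, b, ha, hb, q1, q2⟩ := hbr.abstract_main
  refine ⟨ν, φ, p1, p2, p3, p4, p5, 1/2, by norm_num, ?_⟩
  set β := 1 / γ - 1 with hβd
  obtain ⟨c, hc⟩ : ∃ c, c = Real.log 2 ^ β := ⟨_, rfl⟩
  rw [← hc] at q1 q2
  have hcp := c_pos hc
  refine ⟨a / c, b * (2 / c * 2 ^ β), by positivity, by positivity, ?_⟩
  intro x hx
  have hL := L_pos hx
  have hL2 := L_ge hx
  have hx0 := hx.1
  have hx1 : x ∈ Ioc (0:ℝ) 1 := ⟨hx.1, hx.2.trans (by norm_num)⟩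
  rw [abs_of_neg (by linarith)]
  have hP := Real.rpow_pos_of_pos hL (-β)
  constructor
  · have h1 := q2 x hx
    have hs := s_pos hc hx
    have e : Sfun c β x - x = x * sfun c β x := by rw [Sfun]; ring
    rw [e] at h1
    have h2 : x ≤ Sfun c β x := by rw [Sfun]; nlinarith
    have h3 : a * x ≤ φ x * (x * sfun c β x) := (mul_le_mul_of_nonneg_left h2 ha.le).trans h1
    have h4 : a ≤ φ x * sfun c β x := by
      refine le_of_mul_le_mul_right (h3.trans (le_of_eq ?_)) hx0
      ring
    rw [div_le_iff₀ hcp]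
    refine h4.trans (le_of_eq ?_)
    rw [sfun]; ring
  · have h1 := q1 x hx1
    have hlt := g_ltI hβ hc hx1
    have h2 : φ x ≤ b * (x / (x - gfun c β x)) := by
      rw [← mul_div_assoc, le_div_iff₀ (by linarith)]; exact h1
    have h3 := g_ratio hβ hc hx1
    have h4 : (-Real.log (x / 2)) ^ β ≤ 2 ^ β * (-Real.log x) ^ β := by
      rw [← Real.mul_rpow (by norm_num) hL.le]
      refine Real.rpow_le_rpow ?_ ?_ hβ
      · rw [Real.log_div hx0.ne' (by norm_num)]; linarith [log2_pos]
      · rw [Real.log_div hx0.ne' (by norm_num)]; linarith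
    have h5 : φ x ≤ b * (2 / c * (2 ^ β * (-Real.log x) ^ β)) := by
      refine h2.trans (mul_le_mul_of_nonneg_left (h3.trans ?_) hb.le)
      gcongr
    have h6 : (-Real.log x) ^ (-β) * (-Real.log x) ^ β = 1 := by
      rw [← Real.rpow_add hL]; simp
    calc (-Real.log x) ^ (-β) * φ x
        ≤ (-Real.log x) ^ (-β) * (b * (2 / c * (2 ^ β * (-Real.log x) ^ β))) := by gcongr
      _ = b * (2 / c * 2 ^ β) * ((-Real.log x) ^ (-β) * (-Real.log x) ^ β) := by ring
      _ = _ := by rw [h6, mul_one]
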